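/- For the DRB game on the k-dimensional grid, there exists n0 ∈ ℕ (depending only on k and the granularity γ) such that for all n ≥ n0: the navigable profile r ≡ k and the random profile r ≡ 0 are both strict Nash equilibria, and for every s ∈ Σ with s ∉ {0, k}, the uniform profile r ≡ s is not a Nash equilibrium. -/

import Mathlib

open Finset

noncomputable section

namespace DRB

/-- Nodes of the `k`-dimensional grid (torus) with side length `n`. -/
abbrev Node (n k : ℕ) := Fin k → Fin n

/-- Grid (Manhattan) distance on the torus:
`d_M(u,v) = Σ_i min(|u_i - v_i|, n - |u_i - v_i|)`. -/
def dM (n k : ℕ) (u v : Node n k) : ℕ :=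
  ∑ i, min ((u i : ℤ) - (v i : ℤ)).natAbs (n - ((u i : ℤ) - (v i : ℤ)).natAbs)

/-- All nodes different from `u`. -/
def others (n k : ℕ) (u : Node n k) : Finset (Node n k) :=
  Finset.univ.filter (fun v => v ≠ u)

/-- Normalization constant `c(s) = Σ_{v ≠ u} d_M(u,v)^{-s}` for node `u`. -/
def cnorm (n k : ℕ) (u : Node n k) (s : ℝ) : ℝ :=
  ∑ v ∈ others n k u, (dM n k u v : ℝ) ^ (-s)

/-- Long-range link probability `p_u(v, s) = d_M(u,v)^{-s} / c(s)`. -/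
def linkProb (n k : ℕ) (u v : Node n k) (s : ℝ) : ℝ :=
  (dM n k u v : ℝ) ^ (-s) / cnorm n k u s

/-- Link distance `D(s) = Σ_{v ≠ u} p_u(v,s) · d_M(u,v)` of node `u`. -/
def linkDist (n k : ℕ) (u : Node n k) (s : ℝ) : ℝ :=
  ∑ v ∈ others n k u, linkProb n k u v s * (dM n k u v : ℝ)

/-- Reciprocity `P_u(r) = Σ_{v ≠ u} p_u(v, r_u) · p_v(u, r_v)`. -/
def recip (n k : ℕ) (r : Node n k → ℝ) (u : Node n k) : ℝ :=
  ∑ v ∈ others n k u, linkProb n k u v (r u) * linkProb n k v u (r v)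

/-- DRB payoff `π_u(r) = D(r_u) · P_u(r)`. -/
def payoff (n k : ℕ) (r : Node n k → ℝ) (u : Node n k) : ℝ :=
  linkDist n k u (r u) * recip n k r u

/-- Membership in the strategy set `Σ = {0, γ, 2γ, 3γ, ...}`. -/
def InSigma (γ s : ℝ) : Prop := ∃ m : ℕ, s = m * γ

/-- A valid strategy profile (every coordinate lies in `Σ`). -/
def ValidProfile (n k : ℕ) (γ : ℝ) (r : Node n k → ℝ) : Prop :=
  ∀ u, InSigma γ (r u)

/-- Nash equilibrium of the DRB game with strategy set `Σ` of granularity `γ`. -/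
def IsNash (n k : ℕ) (γ : ℝ) (r : Node n k → ℝ) : Prop :=
  ∀ u : Node n k, ∀ s : ℝ, InSigma γ s →
    payoff n k r u ≥ payoff n k (Function.update r u s) u

/-- Strict Nash equilibrium. -/
def IsStrictNash (n k : ℕ) (γ : ℝ) (r : Node n k → ℝ) : Prop :=
  ∀ u : Node n k, ∀ s : ℝ, InSigma γ s → s ≠ r u →
    payoff n k r u > payoff n k (Function.update r u s) u

/-- `t`-strong Nash equilibrium: no coalition of size ≤ `t` has a weakly
improving joint deviation that strictly improves some member. -/
def IsTStrongNash (n k : ℕ) (γ : ℝ) (t : ℕ) (r : Node n k → ℝ) : Prop :=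
  ¬ ∃ (C : Finset (Node n k)) (s : Node n k → ℝ),
      C.Nonempty ∧ C.card ≤ t ∧ (∀ u ∈ C, InSigma γ (s u)) ∧
      (∀ u ∈ C,
        payoff n k (fun v => if v ∈ C then s v else r v) u ≥ payoff n k r u) ∧
      (∃ u ∈ C,
        payoff n k (fun v => if v ∈ C then s v else r v) u > payoff n k r u)

/-- Strong Nash equilibrium: coalitions of any size. -/
def IsStrongNash (n k : ℕ) (γ : ℝ) (r : Node n k → ℝ) : Prop :=
  ¬ ∃ (C : Finset (Node n k)) (s : Node n k → ℝ),
      C.Nonempty ∧ (∀ u ∈ C, InSigma γ (s u)) ∧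
      (∀ u ∈ C,
        payoff n k (fun v => if v ∈ C then s v else r v) u ≥ payoff n k r u) ∧
      (∃ u ∈ C,
        payoff n k (fun v => if v ∈ C then s v else r v) u > payoff n k r u)

/-- `b_u(j)`: the number of nodes at grid distance exactly `j` from `u`. -/
def countAt (n k : ℕ) (u : Node n k) (j : ℕ) : ℕ :=
  (Finset.univ.filter (fun v => v ≠ u ∧ dM n k u v = j)).card

/-- One asynchronous best-response step: a single node switches to a best
response to the current profile, all other strategies unchanged. -/
def BRStep (n k : ℕ) (γ : ℝ) (r r' : Node n k → ℝ) : Prop :=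
  ∃ (u : Node n k) (s : ℝ), InSigma γ s ∧
    (∀ t : ℝ, InSigma γ t →
      payoff n k (Function.update r u s) u ≥ payoff n k (Function.update r u t) u) ∧
    r' = Function.update r u s

/-- One synchronous best-response step: every node simultaneously switches
to a best response to the current profile `r`. -/
def SyncStep (n k : ℕ) (γ : ℝ) (r r' : Node n k → ℝ) : Prop :=
  ∀ u : Node n k, InSigma γ (r' u) ∧
    ∀ t : ℝ, InSigma γ t →
      payoff n k (Function.update r u (r' u)) u ≥
        payoff n k (Function.update r u t) u


/-! ### Analytic core -/

lemma core_low {A : ℝ → ℝ} {M c γ κ : ℝ} (hM : 1 ≤ M) (hc : 0 < c) (hκ : 1 ≤ κ)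
    (hanti : Antitone A) (hone : ∀ t, 1 ≤ A t)
    (hup : ∀ t, t ≤ κ → A t ≤ M ^ (κ - t) * A κ)
    (hlow : ∀ t, 0 ≤ t → c * M ^ (κ - t) ≤ A t)
    (hL : A κ ^ 4 < c ^ 3 * M ^ γ) {t : ℝ} (ht : 0 ≤ t) (htk : t ≤ κ - γ) (hγ : 0 < γ) :
    A (t - 1) * A (t + κ) * A κ ^ 2 < A (κ - 1) * A (2 * κ) * A t ^ 2 := by
  have hM0 : 0 < M := by linarith
  have hL1 := hone κ
  have h1 : A (t - 1) ≤ M ^ (κ - t) * M * A κ := by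
    have := hup (t - 1) (by linarith)
    rwa [show κ - (t - 1) = (κ - t) + 1 by ring, Real.rpow_add_one hM0.ne'] at this
  have h2 : A (t + κ) ≤ A κ := hanti (by linarith)
  have h3 : c * M ≤ A (κ - 1) := by
    have := hlow (κ - 1) (by linarith)
    rwa [show κ - (κ - 1) = 1 by ring, Real.rpow_one] at this
  have h4 := hlow t ht
  have h5 : M ^ γ ≤ M ^ (κ - t) := Real.rpow_le_rpow_of_exponent_le hM (by linarith)
  have hx : 0 < M ^ (κ - t) := Real.rpow_pos_of_pos hM0 _
  set X := M ^ (κ - t)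
  have hA1 := hone (t - 1)
  have hA2 := hone (t + κ)
  calc A (t - 1) * A (t + κ) * A κ ^ 2 ≤ (X * M * A κ) * A κ * A κ ^ 2 := by
        gcongr
    _ = X * M * A κ ^ 4 := by ring
    _ < X * M * (c ^ 3 * X) := by
        apply mul_lt_mul_of_pos_left _ (by positivity)
        exact hL.trans_le (by gcongr)
    _ = (c * M) * 1 * (c * X) ^ 2 := by ring
    _ ≤ A (κ - 1) * A (2 * κ) * A t ^ 2 := by
        have := hone (2 * κ)
        have hA3 := hone (κ - 1)
        gcongr

lemma core_high {A : ℝ → ℝ} {M c γ κ : ℝ} (hM : 1 ≤ M) (hc : 0 < c) (hc1 : c ≤ 1)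
    (hκ : 1 ≤ κ) (hγ1 : γ ≤ 1)
    (hanti : Antitone A) (hone : ∀ t, 1 ≤ A t)
    (hup : ∀ t, t ≤ κ → A t ≤ M ^ (κ - t) * A κ)
    (hlow : ∀ t, 0 ≤ t → c * M ^ (κ - t) ≤ A t)
    (hL : A κ ^ 4 < c ^ 3 * M ^ γ) {t : ℝ} (htk : κ + γ ≤ t) :
    A (t - 1) * A κ ^ 2 < A (κ - 1) := by
  have hM0 : 0 < M := by linarith
  have hL1 := hone κ
  have h1 : A (t - 1) ≤ M ^ (1 - γ) * A κ := by
    have := hup (κ + γ - 1) (by linarith)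
    rw [show κ - (κ + γ - 1) = 1 - γ by ring] at this
    exact (hanti (by linarith)).trans this
  have h3 : c * M ≤ A (κ - 1) := by
    have := hlow (κ - 1) (by linarith)
    rwa [show κ - (κ - 1) = 1 by ring, Real.rpow_one] at this
  have hx : 0 < M ^ (1 - γ) := Real.rpow_pos_of_pos hM0 _
  have hy : 0 < M ^ γ := Real.rpow_pos_of_pos hM0 _
  have hxy : M ^ (1 - γ) * M ^ γ = M := by
    rw [← Real.rpow_add hM0]; simp
  have hL3 : A κ ^ 3 ≤ A κ ^ 4 := pow_le_pow_right₀ hL1 (by norm_num)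
  have hc3 : c ^ 3 ≤ c := by
    simpa using pow_le_pow_of_le_one hc.le hc1 (show 1 ≤ 3 by norm_num)
  calc A (t - 1) * A κ ^ 2 ≤ (M ^ (1 - γ) * A κ) * A κ ^ 2 := by gcongr
    _ = M ^ (1 - γ) * A κ ^ 3 := by ring
    _ < M ^ (1 - γ) * (c * M ^ γ) := by
        apply mul_lt_mul_of_pos_left _ hx
        have : c ^ 3 * M ^ γ ≤ c * M ^ γ := by gcongr
        linarith
    _ = c * (M ^ (1 - γ) * M ^ γ) := by ring
    _ = c * M := by rw [hxy]
    _ ≤ _ := h3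

lemma core_mid {A : ℝ → ℝ} {M c γ κ : ℝ} (hM : 1 ≤ M) (hc : 0 < c) (hκ : 1 ≤ κ)
    (hanti : Antitone A) (hone : ∀ t, 1 ≤ A t)
    (hup : ∀ t, t ≤ κ → A t ≤ M ^ (κ - t) * A κ)
    (hlow : ∀ t, 0 ≤ t → c * M ^ (κ - t) ≤ A t)
    (hL : A κ ^ 4 < c ^ 3 * M ^ γ) {s : ℝ} (hs : γ ≤ s) (hsk : s ≤ κ - γ) (hγ : 0 < γ) :
    A (s - 1) * A (2 * s) * A κ ^ 2 < A (κ - 1) * A (κ + s) * A s ^ 2 := by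
  have hM0 : 0 < M := by linarith
  have hL1 := hone κ
  have h1 : A (s - 1) ≤ M ^ (κ - s) * M * A κ := by
    have := hup (s - 1) (by linarith)
    rwa [show κ - (s - 1) = (κ - s) + 1 by ring, Real.rpow_add_one hM0.ne'] at this
  have h2 : A (2 * s) ≤ M ^ (κ - s - γ) * A κ := by
    have := hup (s + γ) (by linarith)
    rw [show κ - (s + γ) = κ - s - γ by ring] at this
    exact (hanti (by linarith)).trans this
  have h3 : c * M ≤ A (κ - 1) := by
    have := hlow (κ - 1) (by linarith)
    rwa [show κ - (κ - 1) = 1 by ring, Real.rpow_one] at this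
  have h4 := hlow s (by linarith)
  have hx : 0 < M ^ (κ - s) := Real.rpow_pos_of_pos hM0 _
  have hy : 0 < M ^ (κ - s - γ) := Real.rpow_pos_of_pos hM0 _
  have hxy : M ^ (κ - s - γ) * M ^ γ = M ^ (κ - s) := by
    rw [← Real.rpow_add hM0]; simp
  have hA1 := hone (s - 1)
  have hA2 := hone (2 * s)
  set X := M ^ (κ - s)
  set Y := M ^ (κ - s - γ)
  calc A (s - 1) * A (2 * s) * A κ ^ 2 ≤ (X * M * A κ) * (Y * A κ) * A κ ^ 2 := by
        gcongr
    _ = X * M * Y * A κ ^ 4 := by ring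
    _ < X * M * Y * (c ^ 3 * M ^ γ) := by
        exact mul_lt_mul_of_pos_left hL (by positivity)
    _ = X * M * c ^ 3 * (Y * M ^ γ) := by ring
    _ = (c * M) * 1 * (c * X) ^ 2 := by rw [hxy]; ring
    _ ≤ _ := by
        have := hone (κ + s)
        have hA3 := hone (κ - 1)
        gcongr

/-! ### Geometry -/

/-- one-dimensional torus distance -/
def cd (n : ℕ) (a b : Fin n) : ℕ :=
  min ((a : ℤ) - (b : ℤ)).natAbs (n - ((a : ℤ) - (b : ℤ)).natAbs)

lemma dM_eq (n k : ℕ) (u v : Node n k) : dM n k u v = ∑ i, cd n (u i) (v i) := rfl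

lemma cd_comm (n : ℕ) (a b : Fin n) : cd n a b = cd n b a := by
  unfold cd; omega

lemma dM_comm (n k : ℕ) (u v : Node n k) : dM n k u v = dM n k v u := by
  simp only [dM_eq, cd_comm]

lemma cd_le (n : ℕ) (a b : Fin n) : cd n a b ≤ n := by
  unfold cd; omega

lemma dM_le (n k : ℕ) (u v : Node n k) : dM n k u v ≤ k * n := by
  rw [dM_eq]
  calc _ ≤ ∑ i : Fin k, n := Finset.sum_le_sum fun i _ => cd_le n _ _
    _ = k * n := by simp

lemma cd_pos (n : ℕ) (a b : Fin n) (h : a ≠ b) : 1 ≤ cd n a b := by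
  have : (a : ℕ) ≠ b := fun h' => h (Fin.ext h')
  unfold cd; omega

lemma cd_self (n : ℕ) (a : Fin n) : cd n a a = 0 := by
  unfold cd; omega

lemma dM_pos (n k : ℕ) (u v : Node n k) (h : v ≠ u) : 1 ≤ dM n k u v := by
  obtain ⟨i, hi⟩ := Function.ne_iff.1 h
  rw [dM_eq]
  exact (cd_pos n _ _ hi.symm).trans
    (Finset.single_le_sum (f := fun i => cd n (u i) (v i)) (fun _ _ => Nat.zero_le _)
      (Finset.mem_univ i))

lemma cd_add (n : ℕ) [NeZero n] (a b c : Fin n) : cd n (a + c) (b + c) = cd n a b := by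
  unfold cd
  have ha := a.2
  have hb := b.2
  have hc := c.2
  rw [Fin.val_add_eq_ite, Fin.val_add_eq_ite]
  split_ifs <;> push_cast <;> omega

lemma dM_add (n k : ℕ) [NeZero n] (u v w : Node n k) :
    dM n k (u + w) (v + w) = dM n k u v := by
  simp only [dM_eq, Pi.add_apply, cd_add]

lemma cnorm_eq (n k : ℕ) [NeZero n] (u v : Node n k) (s : ℝ) :
    cnorm n k u s = cnorm n k v s := by
  unfold cnorm others
  refine Finset.sum_bij (fun x _ => x + (v - u)) ?_ ?_ ?_ ?_
  · intro x hx
    simp only [Finset.mem_filter, Finset.mem_univ, true_and] at hx ⊢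
    intro h
    apply hx
    have : x + (v - u) = u + (v - u) := by rw [h]; abel
    exact add_right_cancel this
  · intro x _ y _ h
    exact add_right_cancel h
  · intro y hy
    simp only [Finset.mem_filter, Finset.mem_univ, true_and] at hy ⊢
    refine ⟨y - (v - u), ?_, by abel⟩
    intro h
    apply hy
    rw [sub_eq_iff_eq_add] at h
    rw [h]; abel
  · intro x _
    have : dM n k v (x + (v - u)) = dM n k u x := by
      have := dM_add n k u x (v - u)
      rwa [show u + (v - u) = v by abel] at this
    rw [this]

lemma mem_others {n k : ℕ} {u v : Node n k} : v ∈ others n k u ↔ v ≠ u := by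
  simp [others]

lemma exists_dist (n k : ℕ) (hk : 1 ≤ k) (u : Node n k) (c : ℕ) (hc : 1 ≤ c)
    (hcn : 2 * c ≤ n) : ∃ v ∈ others n k u, dM n k u v = c := by
  let i0 : Fin k := ⟨0, hk⟩
  have hn : 0 < n := by omega
  have key : ∃ b : Fin n, cd n (u i0) b = c := by
    have ha := (u i0).2
    by_cases h : (u i0 : ℕ) + c < n
    · refine ⟨⟨(u i0 : ℕ) + c, h⟩, ?_⟩
      unfold cd; push_cast; omega
    · refine ⟨⟨(u i0 : ℕ) - c, by omega⟩, ?_⟩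
      unfold cd
      have : (((u i0 : ℕ) - c : ℕ) : ℤ) = (u i0 : ℕ) - c := by omega
      simp only [this]
      omega
  obtain ⟨b, hb⟩ := key
  refine ⟨Function.update u i0 b, ?_, ?_⟩
  · rw [mem_others]
    intro h
    have : b = u i0 := by rw [← h]; simp
    rw [this, cd_self] at hb
    omega
  · rw [dM_eq, Finset.sum_eq_single i0]
    · simpa using hb
    · intro j _ hj
      rw [Function.update_of_ne hj, cd_self]
    · simp

lemma cnorm_anti (n k : ℕ) (u : Node n k) : Antitone (cnorm n k u) := by
  intro s t hst
  unfold cnorm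
  refine Finset.sum_le_sum fun v hv => ?_
  have h1 : (1 : ℝ) ≤ dM n k u v := by
    exact_mod_cast dM_pos n k u v (mem_others.1 hv)
  exact Real.rpow_le_rpow_of_exponent_le h1 (by linarith)

lemma one_le_cnorm (n k : ℕ) (hk : 1 ≤ k) (hn : 2 ≤ n) (u : Node n k) (t : ℝ) :
    1 ≤ cnorm n k u t := by
  obtain ⟨v, hv, hd⟩ := exists_dist n k hk u 1 le_rfl (by omega)
  unfold cnorm
  refine le_trans ?_ (Finset.single_le_sum (fun w _ => ?_) hv)
  · simp [hd]
  · positivity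

lemma cnorm_up (n k : ℕ) (u : Node n k) (t : ℝ) (ht : t ≤ k) :
    cnorm n k u t ≤ ((k : ℝ) * n) ^ ((k : ℝ) - t) * cnorm n k u k := by
  unfold cnorm
  rw [Finset.mul_sum]
  refine Finset.sum_le_sum fun v hv => ?_
  have h1 : (1 : ℝ) ≤ dM n k u v := by
    exact_mod_cast dM_pos n k u v (mem_others.1 hv)
  have h2 : (dM n k u v : ℝ) ≤ (k : ℝ) * n := by
    exact_mod_cast dM_le n k u v
  rw [show -t = ((k : ℝ) - t) + (-k) by ring, Real.rpow_add (by linarith)]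
  gcongr

lemma card_others (n k : ℕ) (u : Node n k) : (others n k u).card = n ^ k - 1 := by
  unfold others
  rw [Finset.filter_ne', Finset.card_erase_of_mem (Finset.mem_univ _)]
  simp

lemma cnorm_low (n k : ℕ) (hk : 1 ≤ k) (hn : 2 ≤ n) (u : Node n k) (t : ℝ) (ht : 0 ≤ t) :
    (1 / (2 * (k : ℝ) ^ k)) * ((k : ℝ) * n) ^ ((k : ℝ) - t) ≤ cnorm n k u t := by
  have hk0 : (0 : ℝ) < k := by exact_mod_cast hk
  have hn0 : (0 : ℝ) < n := by exact_mod_cast (by omega : 0 < n)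
  have hM : (0 : ℝ) < (k : ℝ) * n := by positivity
  have h1 : ((n ^ k - 1 : ℕ) : ℝ) * ((k : ℝ) * n) ^ (-t) ≤ cnorm n k u t := by
    unfold cnorm
    rw [← card_others n k u, ← nsmul_eq_mul]
    refine Finset.card_nsmul_le_sum _ _ _ fun v hv => ?_
    have h1 : (1 : ℝ) ≤ dM n k u v := by
      exact_mod_cast dM_pos n k u v (mem_others.1 hv)
    have h2 : (dM n k u v : ℝ) ≤ (k : ℝ) * n := by
      exact_mod_cast dM_le n k u v
    exact Real.rpow_le_rpow_of_nonpos (by linarith) h2 (by linarith)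
  refine le_trans ?_ h1
  rw [sub_eq_add_neg, Real.rpow_add hM, ← mul_assoc]
  gcongr
  rw [Real.rpow_natCast, mul_pow]
  have h2 : 2 ≤ n ^ k := hn.trans (Nat.le_self_pow (by omega) n)
  rw [Nat.cast_sub (by omega)]
  have h3 : (2 : ℝ) ≤ (n : ℝ) ^ k := by exact_mod_cast h2
  push_cast
  have : 1 / (2 * (k : ℝ) ^ k) * ((k : ℝ) ^ k * (n : ℝ) ^ k) = (n : ℝ) ^ k / 2 := by
    field_simp
  rw [this]
  linarith

/-! ### Logarithmic bound for the normalisation at `k` -/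

lemma sum_fin_le (n : ℕ) (a : Fin n) (f : ℕ → ℝ) (hf : ∀ j, 0 ≤ f j) :
    ∑ b : Fin n, f ((a : ℤ) - (b : ℤ)).natAbs ≤ 2 * ∑ j ∈ Finset.range n, f j := by
  have ha := a.2
  rw [Fin.sum_univ_eq_sum_range (fun b => f ((a : ℤ) - (b : ℤ)).natAbs) n,
    ← Finset.sum_filter_add_sum_filter_not (Finset.range n) (fun b => b ≤ (a : ℕ)), two_mul]
  apply add_le_add
  · rw [← Finset.sum_image (s := (Finset.range n).filter (fun b => b ≤ (a : ℕ)))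
      (g := fun b : ℕ => ((a : ℤ) - (b : ℤ)).natAbs) (f := f)]
    · refine Finset.sum_le_sum_of_subset_of_nonneg ?_ (fun j _ _ => hf j)
      intro j hj
      simp only [Finset.mem_image, Finset.mem_filter, Finset.mem_range] at hj ⊢
      obtain ⟨b, hb, rfl⟩ := hj
      omega
    · intro x hx y hy hxy
      simp only [Finset.coe_filter, Finset.mem_range, Set.mem_ofPred_eq] at hx hy hxy
      omega
  · rw [← Finset.sum_image (s := (Finset.range n).filter (fun b => ¬ b ≤ (a : ℕ)))
      (g := fun b : ℕ => ((a : ℤ) - (b : ℤ)).natAbs) (f := f)]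
    · refine Finset.sum_le_sum_of_subset_of_nonneg ?_ (fun j _ _ => hf j)
      intro j hj
      simp only [Finset.mem_image, Finset.mem_filter, Finset.mem_range] at hj ⊢
      obtain ⟨b, hb, rfl⟩ := hj
      omega
    · intro x hx y hy hxy
      simp only [Finset.coe_filter, Finset.mem_range, Set.mem_ofPred_eq] at hx hy hxy
      omega

lemma sum_harm (n : ℕ) (hn : 1 ≤ n) :
    ∑ j ∈ Finset.range n, ((j : ℝ) + 1)⁻¹ ≤ 1 + Real.log n := by
  have := harmonic_le_one_add_log n
  unfold harmonic at this
  push_cast at this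
  exact this

lemma sum_cd_le (n : ℕ) (hn : 1 ≤ n) (a : Fin n) :
    ∑ b : Fin n, ((max (cd n a b) 1 : ℕ) : ℝ)⁻¹ ≤ 6 * (1 + Real.log n) := by
  have h1 := sum_fin_le n a (fun j => ((max (min j (n - j)) 1 : ℕ) : ℝ)⁻¹)
    (fun j => by positivity)
  have h2 : ∑ j ∈ Finset.range n, ((max (min j (n - j)) 1 : ℕ) : ℝ)⁻¹ ≤
      ∑ j ∈ Finset.range n, (2 * ((j : ℝ) + 1)⁻¹ + (((n - 1 - j : ℕ) : ℝ) + 1)⁻¹) := by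
    refine Finset.sum_le_sum fun j hj => ?_
    rw [Finset.mem_range] at hj
    rcases le_total j (n - j) with h | h
    · have h3 : ((j : ℝ) + 1) / 2 ≤ ((max (min j (n - j)) 1 : ℕ) : ℝ) := by
        rw [div_le_iff₀ (by norm_num)]
        exact_mod_cast (by omega : j + 1 ≤ (max (min j (n - j)) 1) * 2)
      have h4 := inv_anti₀ (by positivity) h3
      have h5 : (((j : ℝ) + 1) / 2)⁻¹ = 2 * ((j : ℝ) + 1)⁻¹ := by
        rw [inv_div]; rfl
      have h6 : 0 ≤ (((n - 1 - j : ℕ) : ℝ) + 1)⁻¹ := by positivity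
      linarith
    · have h3 : (((n - 1 - j : ℕ) : ℝ) + 1) ≤ ((max (min j (n - j)) 1 : ℕ) : ℝ) := by
        exact_mod_cast (by omega : (n - 1 - j) + 1 ≤ (max (min j (n - j)) 1))
      have h4 := inv_anti₀ (by positivity) h3
      have h6 : 0 ≤ 2 * ((j : ℝ) + 1)⁻¹ := by positivity
      linarith
  rw [Finset.sum_add_distrib, ← Finset.mul_sum,
    Finset.sum_range_reflect (fun j => ((j : ℝ) + 1)⁻¹) n] at h2
  have h3 := sum_harm n hn
  calc ∑ b : Fin n, ((max (cd n a b) 1 : ℕ) : ℝ)⁻¹ ≤ _ := h1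
    _ ≤ 6 * (1 + Real.log n) := by linarith

lemma cnorm_log (n k : ℕ) (hn : 1 ≤ n) (u : Node n k) :
    cnorm n k u k ≤ (6 * (1 + Real.log n)) ^ k := by
  calc cnorm n k u k ≤ ∑ v ∈ others n k u, ∏ i, ((max (cd n (u i) (v i)) 1 : ℕ) : ℝ)⁻¹ := by
        unfold cnorm
        refine Finset.sum_le_sum fun v hv => ?_
        have h1 := dM_pos n k u v (mem_others.1 hv)
        have h2 : (1 : ℝ) ≤ dM n k u v := by exact_mod_cast h1
        rw [Real.rpow_neg (by positivity), Real.rpow_natCast, ← inv_pow]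
        calc ((dM n k u v : ℝ)⁻¹) ^ k = ∏ i : Fin k, (dM n k u v : ℝ)⁻¹ := by simp
          _ ≤ _ := by
            refine Finset.prod_le_prod (fun _ _ => by positivity) fun i _ => ?_
            have h3 : cd n (u i) (v i) ≤ dM n k u v :=
              Finset.single_le_sum (f := fun i => cd n (u i) (v i))
                (fun _ _ => Nat.zero_le _) (Finset.mem_univ i)
            refine inv_anti₀ (by positivity) ?_
            exact_mod_cast max_le h3 h1
    _ ≤ ∑ v : Node n k, ∏ i, ((max (cd n (u i) (v i)) 1 : ℕ) : ℝ)⁻¹ := by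
        refine Finset.sum_le_sum_of_subset_of_nonneg (Finset.subset_univ _) fun _ _ _ => ?_
        positivity
    _ = ∏ i : Fin k, ∑ b : Fin n, ((max (cd n (u i) b) 1 : ℕ) : ℝ)⁻¹ := by
        rw [Finset.prod_univ_sum]
        simp
    _ ≤ ∏ i : Fin k, (6 * (1 + Real.log n)) := by
        refine Finset.prod_le_prod (fun _ _ => by positivity) fun i _ => sum_cd_le n hn (u i)
    _ = _ := by simp

lemma eventually_log (k : ℕ) (hk : 1 ≤ k) (γ C : ℝ) (hγ : 0 < γ) (hC : 0 < C) :
    ∃ n0 : ℕ, ∀ n : ℕ, n0 ≤ n →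
      ((6 * (1 + Real.log n)) ^ k) ^ 4 < C * ((k : ℝ) * n) ^ γ := by
  have hk0 : (0 : ℝ) < k := by exact_mod_cast hk
  set ε : ℝ := γ / (k * 4) with hε
  have hε0 : 0 < ε := by positivity
  have h1 : (fun x : ℝ => Real.log x) =o[Filter.atTop] fun x => x ^ ε :=
    isLittleO_log_rpow_atTop hε0
  have h2 : (fun _ : ℝ => (1 : ℝ)) =o[Filter.atTop] fun x => x ^ ε := by
    rw [Asymptotics.isLittleO_one_left_iff]
    exact tendsto_norm_atTop_atTop.comp (tendsto_rpow_atTop hε0)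
  have h3 := (((h2.add h1).const_mul_left 6).pow (n := k * 4) (by omega)).def
    (c := C / 2) (by positivity)
  have h4 := (tendsto_natCast_atTop_atTop (R := ℝ)).eventually h3
  obtain ⟨n0, hn0⟩ := Filter.eventually_atTop.1 h4
  refine ⟨max n0 1, fun n hn => ?_⟩
  have h5 := hn0 n (le_trans (le_max_left _ _) hn)
  have hn1 : (1 : ℝ) ≤ n := by exact_mod_cast le_trans (le_max_right _ _) hn
  have h6 : ((n : ℝ) ^ ε) ^ (k * 4) = (n : ℝ) ^ γ := by
    rw [← Real.rpow_natCast, ← Real.rpow_mul (by positivity)]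
    congr 1
    rw [hε]; push_cast; field_simp
  rw [h6, Real.norm_eq_abs, Real.norm_eq_abs] at h5
  have h7 : 0 < (n : ℝ) ^ γ := Real.rpow_pos_of_pos (by linarith) _
  rw [abs_of_pos h7] at h5
  have h8 : (n : ℝ) ^ γ ≤ ((k : ℝ) * n) ^ γ := by
    apply Real.rpow_le_rpow (by linarith) _ hγ.le
    have : (1 : ℝ) ≤ k := by exact_mod_cast hk
    nlinarith
  rw [← pow_mul]
  calc _ ≤ C / 2 * (n : ℝ) ^ γ := (le_abs_self _).trans h5
    _ < C * (n : ℝ) ^ γ := by nlinarith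
    _ ≤ _ := by gcongr

/-! ### Payoffs -/

lemma payoff_eq (n k : ℕ) [NeZero n] (u : Node n k) (s t : ℝ) :
    payoff n k (Function.update (fun _ => s) u t) u =
      cnorm n k u (t - 1) * cnorm n k u (t + s) / (cnorm n k u t ^ 2 * cnorm n k u s) := by
  have h1 : linkDist n k u t = cnorm n k u (t - 1) / cnorm n k u t := by
    unfold linkDist linkProb
    conv_rhs => rw [cnorm, Finset.sum_div]
    refine Finset.sum_congr rfl fun v hv => ?_
    have h1 : (1 : ℝ) ≤ dM n k u v := by
      exact_mod_cast dM_pos n k u v (mem_others.1 hv)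
    rw [show -(t - 1) = -t + 1 by ring, Real.rpow_add_one (by positivity)]
    ring
  have h2 : recip n k (Function.update (fun _ => s) u t) u =
      cnorm n k u (t + s) / (cnorm n k u t * cnorm n k u s) := by
    unfold recip linkProb
    conv_rhs => rw [cnorm, Finset.sum_div]
    refine Finset.sum_congr rfl fun v hv => ?_
    have h1 : (1 : ℝ) ≤ dM n k u v := by
      exact_mod_cast dM_pos n k u v (mem_others.1 hv)
    rw [Function.update_self, Function.update_of_ne (mem_others.1 hv), cnorm_eq n k v u,
      dM_comm n k v u, neg_add, Real.rpow_add (by positivity), div_mul_div_comm]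
  unfold payoff
  rw [Function.update_self, h1, h2, div_mul_div_comm]
  congr 1
  ring

lemma payoff_uniform (n k : ℕ) [NeZero n] (u : Node n k) (s : ℝ) :
    payoff n k (fun _ => s) u =
      cnorm n k u (s - 1) * cnorm n k u (s + s) / (cnorm n k u s ^ 2 * cnorm n k u s) := by
  rw [← payoff_eq]
  congr 1
  exact (Function.update_eq_self u (fun _ => s)).symm

/-- strict Chebyshev inequality -/
lemma cheb (n k : ℕ) (hk : 1 ≤ k) (hn : 4 ≤ n) (u : Node n k) (t : ℝ) (ht : 0 < t) :
    cnorm n k u (t - 1) * cnorm n k u 0 < cnorm n k u (-1) * cnorm n k u t := by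
  have hA0 := one_le_cnorm n k hk (by omega) u 0
  have hAm := one_le_cnorm n k hk (by omega) u (-1)
  set D := cnorm n k u (-1) / cnorm n k u 0 with hD
  have hD0 : 0 < D := by positivity
  have hDeq : D * cnorm n k u 0 = cnorm n k u (-1) := by
    rw [hD]; field_simp
  have hterm : ∀ d : ℝ, 0 < d → (d - D) * (d ^ (-t) - D ^ (-t)) ≤ 0 := by
    intro d hd
    rcases le_total d D with h | h
    · have := Real.rpow_le_rpow_of_nonpos hd h (by linarith : -t ≤ 0)
      nlinarith
    · have := Real.rpow_le_rpow_of_nonpos hD0 h (by linarith : -t ≤ 0)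
      nlinarith
  have hstrict : ∀ d : ℝ, 0 < d → d ≠ D → (d - D) * (d ^ (-t) - D ^ (-t)) < 0 := by
    intro d hd hne
    rcases lt_or_gt_of_ne hne with h | h
    · have := Real.rpow_lt_rpow_of_neg hd h (by linarith : -t < 0)
      nlinarith
    · have := Real.rpow_lt_rpow_of_neg hD0 h (by linarith : -t < 0)
      nlinarith
  have hpos : ∀ v ∈ others n k u, (0 : ℝ) < dM n k u v := fun v hv => by
    exact_mod_cast dM_pos n k u v (mem_others.1 hv)
  have hex : ∃ v ∈ others n k u, (dM n k u v : ℝ) ≠ D := by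
    obtain ⟨v, hv, hdv⟩ := exists_dist n k hk u 1 le_rfl (by omega)
    obtain ⟨w, hw, hdw⟩ := exists_dist n k hk u 2 (by norm_num) (by omega)
    by_cases h : (dM n k u v : ℝ) = D
    · refine ⟨w, hw, ?_⟩
      rw [← h, hdv, hdw]; norm_num
    · exact ⟨v, hv, h⟩
  have hsum : ∑ v ∈ others n k u,
      ((dM n k u v : ℝ) - D) * ((dM n k u v : ℝ) ^ (-t) - D ^ (-t)) < 0 := by
    obtain ⟨v, hv, hne⟩ := hex
    exact Finset.sum_neg' (fun w hw => hterm _ (hpos w hw)) ⟨v, hv, hstrict _ (hpos v hv) hne⟩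
  have hexp : ∑ v ∈ others n k u,
      ((dM n k u v : ℝ) - D) * ((dM n k u v : ℝ) ^ (-t) - D ^ (-t)) =
      cnorm n k u (t - 1) - D * cnorm n k u t -
        D ^ (-t) * (cnorm n k u (-1) - D * cnorm n k u 0) := by
    unfold cnorm
    simp only [Finset.mul_sum, ← Finset.sum_sub_distrib]
    refine Finset.sum_congr rfl fun v hv => ?_
    have := hpos v hv
    rw [show -(t - 1) = -t + 1 by ring, Real.rpow_add_one this.ne']
    simp only [neg_neg, Real.rpow_one, neg_zero, Real.rpow_zero]
    ring
  rw [hexp, hDeq] at hsum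
  have h9 : cnorm n k u (t - 1) < D * cnorm n k u t := by linarith
  calc cnorm n k u (t - 1) * cnorm n k u 0 < D * cnorm n k u t * cnorm n k u 0 := by
        gcongr
    _ = D * cnorm n k u 0 * cnorm n k u t := by ring
    _ = _ := by rw [hDeq]

/-- Elements of `Σ` other than an integer `a` are at distance at least `γ` from it. -/
lemma sigma_gap (g a : ℕ) (hg : 2 ≤ g) (s : ℝ) (hs : InSigma (g : ℝ)⁻¹ s) (hne : s ≠ a) :
    s ≤ a - (g : ℝ)⁻¹ ∨ a + (g : ℝ)⁻¹ ≤ s := by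
  obtain ⟨m, rfl⟩ := hs
  have hg0 : (0 : ℝ) < g := by exact_mod_cast (by omega : 0 < g)
  have ha : (a : ℝ) = ((a * g : ℕ) : ℝ) * (g : ℝ)⁻¹ := by push_cast; field_simp
  rcases lt_trichotomy m (a * g) with h | h | h
  · left
    have : (m : ℝ) + 1 ≤ ((a * g : ℕ) : ℝ) := by exact_mod_cast h
    have h2 : 0 < (g : ℝ)⁻¹ := by positivity
    rw [ha]; nlinarith
  · exact absurd (by rw [ha, h]) hne
  · right
    have : ((a * g : ℕ) : ℝ) + 1 ≤ (m : ℝ) := by exact_mod_cast h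
    have h2 : 0 < (g : ℝ)⁻¹ := by positivity
    rw [ha]; nlinarith

end DRB



/-- For sufficiently large `n`, the navigable profile `r ≡ k` and the
random profile `r ≡ 0` are strict Nash equilibria, and no other uniform profile
`r ≡ s` (with `s ∈ Σ`, `s ∉ {0, k}`) is a Nash equilibrium. -/
theorem two_uniform_equilibria (k g : ℕ) (hk : 1 ≤ k) (hg : 2 ≤ g) :
    ∃ n0 : ℕ, ∀ n : ℕ, n0 ≤ n →
      DRB.IsStrictNash n k (g : ℝ)⁻¹ (fun _ => (k : ℝ)) ∧
      DRB.IsStrictNash n k (g : ℝ)⁻¹ (fun _ => (0 : ℝ)) ∧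
      ∀ s : ℝ, DRB.InSigma (g : ℝ)⁻¹ s → s ≠ 0 → s ≠ (k : ℝ) →
        ¬ DRB.IsNash n k (g : ℝ)⁻¹ (fun _ => s) := by
  have hg0 : (0 : ℝ) < g := by exact_mod_cast (by omega : 0 < g)
  have hγ : 0 < (g : ℝ)⁻¹ := by positivity
  have hγ1 : (g : ℝ)⁻¹ ≤ 1 := inv_le_one_of_one_le₀ (by exact_mod_cast (by omega : 1 ≤ g))
  have hk1 : (1 : ℝ) ≤ k := by exact_mod_cast hk
  have hkk : (1 : ℝ) ≤ (k : ℝ) ^ k := one_le_pow₀ hk1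
  set c : ℝ := 1 / (2 * (k : ℝ) ^ k) with hcdef
  have hc : 0 < c := by positivity
  have hc1 : c ≤ 1 := by
    rw [hcdef, div_le_one (by positivity)]; linarith
  obtain ⟨n0, hn0⟩ := DRB.eventually_log k hk (g : ℝ)⁻¹ (c ^ 3) hγ (by positivity)
  refine ⟨max n0 4, fun n hn => ?_⟩
  have hn4 : 4 ≤ n := le_trans (le_max_right _ _) hn
  have hlog := hn0 n (le_trans (le_max_left _ _) hn)
  haveI : NeZero n := ⟨by omega⟩
  have hM : (1 : ℝ) ≤ (k : ℝ) * n := by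
    exact_mod_cast Nat.mul_pos hk (by omega : 0 < n)
  have hanti := DRB.cnorm_anti n k
  have hone := DRB.one_le_cnorm n k hk (by omega)
  have hup := DRB.cnorm_up n k
  have hlow := DRB.cnorm_low n k hk (by omega)
  have hL : ∀ u, DRB.cnorm n k u k ^ 4 < c ^ 3 * ((k : ℝ) * n) ^ (g : ℝ)⁻¹ := fun u => by
    refine lt_of_le_of_lt ?_ hlog
    have := hone u k
    exact pow_le_pow_left₀ (by linarith) (DRB.cnorm_log n k (by omega) u) 4
  have hSnn : ∀ s, DRB.InSigma (g : ℝ)⁻¹ s → 0 ≤ s := by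
    rintro s ⟨m, rfl⟩
    positivity
  refine ⟨?_, ?_, ?_⟩
  · intro u s hs hne
    rw [gt_iff_lt, DRB.payoff_eq, DRB.payoff_uniform, ← two_mul]
    have p1 := hone u k
    have p2 := hone u s
    have p3 := hone u (k - 1)
    have p4 := hone u (2 * k)
    rw [div_lt_div_iff₀ (by positivity) (by positivity)]
    have key : DRB.cnorm n k u (s - 1) * DRB.cnorm n k u (s + k) * DRB.cnorm n k u k ^ 2 <
        DRB.cnorm n k u (k - 1) * DRB.cnorm n k u (2 * k) * DRB.cnorm n k u s ^ 2 := by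
      rcases DRB.sigma_gap g k hg s hs hne with h | h
      · exact DRB.core_low hM hc hk1 (hanti u) (hone u) (hup u) (hlow u) (hL u)
          (hSnn s hs) h hγ
      · have h1 := DRB.core_high hM hc hc1 hk1 hγ1 (hanti u) (hone u) (hup u) (hlow u) (hL u) h
        have h2 : DRB.cnorm n k u (s + k) ≤ DRB.cnorm n k u (2 * k) := hanti u (by linarith)
        have h3 := hone u (s - 1)
        calc _ = DRB.cnorm n k u (s - 1) * DRB.cnorm n k u k ^ 2 * DRB.cnorm n k u (s + k) := by
              ring
          _ ≤ DRB.cnorm n k u (s - 1) * DRB.cnorm n k u k ^ 2 * DRB.cnorm n k u (2 * k) := by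
              gcongr
          _ < DRB.cnorm n k u (k - 1) * DRB.cnorm n k u (2 * k) := by
              gcongr
          _ ≤ _ := le_mul_of_one_le_right (by positivity) (one_le_pow₀ p2)
    have := mul_lt_mul_of_pos_right key (by positivity : 0 < DRB.cnorm n k u k)
    linarith
  · intro u s hs hne
    have hs0 : 0 < s := lt_of_le_of_ne (hSnn s hs) (Ne.symm hne)
    rw [gt_iff_lt, DRB.payoff_eq, DRB.payoff_uniform]
    have p1 := hone u 0
    have p2 := hone u s
    rw [div_lt_div_iff₀ (by positivity) (by positivity)]
    simp only [add_zero, zero_sub]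
    have key := mul_lt_mul_of_pos_right (DRB.cheb n k hk hn4 u s hs0)
      (by positivity : 0 < DRB.cnorm n k u s * DRB.cnorm n k u 0 ^ 2)
    linarith
  · intro s hs hs0 hsk hN
    have hs0' : (g : ℝ)⁻¹ ≤ s := by
      rcases DRB.sigma_gap g 0 hg s hs (by simpa using hs0) with h | h
      · have := hSnn s hs
        simp at h
        linarith
      · simpa using h
    have h := hN (fun _ => 0) k ⟨k * g, by push_cast; field_simp⟩
    generalize (fun _ => 0 : DRB.Node n k) = u at h
    rw [ge_iff_le, DRB.payoff_eq, DRB.payoff_uniform, ← two_mul] at h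
    have p1 := hone u k
    have p2 := hone u s
    have p3 := hone u (k + s)
    have p4 := hone u (2 * s)
    rw [div_le_div_iff₀ (by positivity) (by positivity)] at h
    have key : DRB.cnorm n k u (s - 1) * DRB.cnorm n k u (2 * s) * DRB.cnorm n k u k ^ 2 <
        DRB.cnorm n k u (k - 1) * DRB.cnorm n k u (k + s) * DRB.cnorm n k u s ^ 2 := by
      rcases DRB.sigma_gap g k hg s hs hsk with h | h
      · exact DRB.core_mid hM hc hk1 (hanti u) (hone u) (hup u) (hlow u) (hL u) hs0' h hγ
      · have h1 := DRB.core_high hM hc hc1 hk1 hγ1 (hanti u) (hone u) (hup u) (hlow u) (hL u) h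
        have h2 : DRB.cnorm n k u (2 * s) ≤ DRB.cnorm n k u (k + s) := hanti u (by linarith)
        have h3 := hone u (s - 1)
        have h4 := hone u (k - 1)
        calc _ = DRB.cnorm n k u (s - 1) * DRB.cnorm n k u k ^ 2 * DRB.cnorm n k u (2 * s) := by
              ring
          _ ≤ DRB.cnorm n k u (s - 1) * DRB.cnorm n k u k ^ 2 * DRB.cnorm n k u (k + s) := by
              gcongr
          _ < DRB.cnorm n k u (k - 1) * DRB.cnorm n k u (k + s) := by
              gcongr
          _ ≤ _ := le_mul_of_one_le_right (by positivity) (one_le_pow₀ p2)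
    have := mul_lt_mul_of_pos_right key (by positivity : 0 < DRB.cnorm n k u s)
    linarith
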